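/- arXiv:2510.02068 — 9 statements merged into one kernel-verified Lean document; each statement's English description precedes it below -/
import Mathlib

section
/- Let c be a rack and c' ⊆ c a subrack. If x ∈ c' and y ∈ N_c(c'), then x ▷ y ∈ N_c(c'). (That is, c' normalizes the normalizer N_c(c').) -/
/-- The normalizer of a subset `c'` of a rack `c`: the set of `x` with `x ◃ y ∈ c'`
for every `y ∈ c'`. -/
def rackNormalizer {c : Type*} [Rack c] (c' : Set c) : Set c :=
  {x : c | ∀ y ∈ c', Shelf.act x y ∈ c'}

/-- If `c'` is a subrack of a rack `c`, `x ∈ c'` and `y ∈ N_c(c')`, then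
`x ◃ y ∈ N_c(c')`. -/
theorem stmt_0 {c : Type*} [Rack c] (c' : Set c)
    (hact : ∀ x ∈ c', ∀ y ∈ c', Shelf.act x y ∈ c')
    (hinv : ∀ x ∈ c', ∀ y ∈ c', Rack.invAct x y ∈ c')
    (x : c) (hx : x ∈ c') (y : c) (hy : y ∈ rackNormalizer c') :
    Shelf.act x y ∈ rackNormalizer c' := by
  intro z hz
  rw [← Rack.act_invAct_eq x z, ← Shelf.self_distrib]
  exact hact x hx _ (hy _ (hinv x hx z hz))
end

section
/- Let c be a rack and c' ⊆ c a normal subrack. If x ∼ x' and y ∼ y', then x ▷ y ∼ x' ▷ y'. Consequently the operation x̄ ▷ ȳ := (x ▷ y)‾ on the quotient set c/c' is well defined, independent of the choice of representatives x and y. -/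
/-- The relation on a rack `c` whose equivalence closure defines the quotient `c/c'`
by a (normal) subrack `c'`: `x` is related to `w ◃ x` for `w ∈ c'`. -/
def quotRel {c : Type*} [Rack c] (c' : Set c) : c → c → Prop :=
  fun x y => ∃ w ∈ c', Shelf.act w x = y

open Relation in
theorem eqvGen_act_right {c : Type*} [Rack c] {c' : Set c}
    (hnormal : ∀ (x : c), ∀ y ∈ c', Shelf.act x y ∈ c') (x : c) {y y' : c}
    (hy : EqvGen (quotRel c') y y') :
    EqvGen (quotRel c') (Shelf.act x y) (Shelf.act x y') := by
  induction hy with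
  | rel y y' h =>
    obtain ⟨w, hw, rfl⟩ := h
    exact .rel _ _ ⟨Shelf.act x w, hnormal x w hw, Shelf.self_distrib.symm⟩
  | refl y => exact .refl _
  | symm _ _ _ ih => exact ih.symm
  | trans _ _ _ _ _ ih ih' => exact ih.trans _ _ _ ih'

open Relation in
theorem eqvGen_act_left {c : Type*} [Rack c] {c' : Set c}
    (hnormal : ∀ (x : c), ∀ y ∈ c', Shelf.act x y ∈ c') {x x' : c} (y : c)
    (hx : EqvGen (quotRel c') x x') :
    EqvGen (quotRel c') (Shelf.act x y) (Shelf.act x' y) := by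
  induction hx with
  | rel x x' h =>
    obtain ⟨w, hw, rfl⟩ := h
    obtain ⟨z, rfl⟩ : ∃ z, Shelf.act w z = y := ⟨Rack.invAct w y, Rack.right_inv w y⟩
    have hz : EqvGen (quotRel c') (Shelf.act x (Shelf.act w z)) (Shelf.act x z) :=
      eqvGen_act_right hnormal x (.symm _ _ (.rel _ _ ⟨w, hw, rfl⟩))
    exact hz.trans _ _ _ (.rel _ _ ⟨w, hw, Shelf.self_distrib⟩)
  | refl x => exact .refl _
  | symm _ _ _ ih => exact ih.symm
  | trans _ _ _ _ _ ih ih' => exact ih.trans _ _ _ ih'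

/-- Let `c'` be a normal subrack of a rack `c` and let `∼` be the equivalence relation
generated by `x ∼ w ◃ x` for `w ∈ c'`.  If `x ∼ x'` and `y ∼ y'` then
`x ◃ y ∼ x' ◃ y'`; consequently the operation `x̄ ▷ ȳ := (x ▷ y)‾` on the quotient
set `c/c'` is well defined. -/
theorem stmt_2 {c : Type*} [Rack c] (c' : Set c)
    (hact : ∀ x ∈ c', ∀ y ∈ c', Shelf.act x y ∈ c')
    (hinv : ∀ x ∈ c', ∀ y ∈ c', Rack.invAct x y ∈ c')
    (hnormal : ∀ (x : c), ∀ y ∈ c', Shelf.act x y ∈ c')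
    (x x' y y' : c)
    (hx : Relation.EqvGen (quotRel c') x x')
    (hy : Relation.EqvGen (quotRel c') y y') :
    Relation.EqvGen (quotRel c') (Shelf.act x y) (Shelf.act x' y') ∧
      Quot.mk (quotRel c') (Shelf.act x y) = Quot.mk (quotRel c') (Shelf.act x' y') := by
  have h : Relation.EqvGen (quotRel c') (Shelf.act x y) (Shelf.act x' y') :=
    .trans _ _ _ (eqvGen_act_left hnormal y hx) (eqvGen_act_right hnormal x' hy)
  exact ⟨h, Quot.eqvGen_sound h⟩
end

section
/- Let c be a finite rack and c' ⊆ c a normal subrack. Then the quotient set c/c', equipped with the operation x̄ ▷ ȳ := (x ▷ y)‾, is again a rack (each class acts bijectively on c/c' and self-distributivity holds), and the projection c → c/c', x ↦ x̄, is a surjective rack homomorphism. -/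
theorem Rack.invAct_mem_of_act_mem {c : Type*} [Finite c] [Rack c] {s : Set c} {x : c}
    (hs : ∀ y ∈ s, Shelf.act x y ∈ s) {y : c} (hy : y ∈ s) : Rack.invAct x y ∈ s := by
  have hinj : Function.Injective (fun z : s => (⟨Shelf.act x z, hs z z.2⟩ : s)) := fun a b h =>
    Subtype.ext ((Rack.left_cancel x).1 (congrArg Subtype.val h))
  obtain ⟨z, hz⟩ := Finite.surjective_of_injective hinj ⟨y, hy⟩
  have hzy : Shelf.act x (z : c) = y := congrArg Subtype.val hz
  rw [← hzy, Rack.invAct_act_eq]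
  exact z.2

theorem quotRel_act_left {c : Type*} [Rack c] {s : Set c} {x y z : c}
    (hs : ∀ w ∈ s, Shelf.act x w ∈ s) (h : quotRel s y z) :
    quotRel s (Shelf.act x y) (Shelf.act x z) := by
  obtain ⟨w, hw, rfl⟩ := h
  exact ⟨Shelf.act x w, hs w hw, Shelf.self_distrib.symm⟩

theorem quotRel_invAct_left {c : Type*} [Rack c] {s : Set c} {x y z : c}
    (hs : ∀ w ∈ s, Rack.invAct x w ∈ s) (h : quotRel s y z) :
    quotRel s (Rack.invAct x y) (Rack.invAct x z) := by
  obtain ⟨w, hw, rfl⟩ := h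
  refine ⟨Rack.invAct x w, hs w hw, (Rack.left_cancel x).1 ?_⟩
  rw [Shelf.self_distrib]
  simp only [Rack.act_invAct_eq]

theorem quot_mk_act_eq_of_quotRel {c : Type*} [Rack c] {s : Set c} {x y : c} (z : c)
    (hs : ∀ w ∈ s, Shelf.act x w ∈ s) (h : quotRel s x y) :
    Quot.mk (quotRel s) (Shelf.act x z) = Quot.mk (quotRel s) (Shelf.act y z) := by
  obtain ⟨w, hw, rfl⟩ := h
  have hz : Shelf.act w (Rack.invAct w z) = z := Rack.act_invAct_eq w z
  rw [← hz, ← Shelf.self_distrib]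
  exact (Quot.sound (quotRel_act_left hs ⟨w, hw, rfl⟩)).symm.trans (Quot.sound ⟨w, hw, rfl⟩)

/-- Let `c` be a finite rack and `c'` a normal subrack.  Then the quotient set `c/c'`
carries an operation with `x̄ ▷ ȳ = (x ▷ y)‾` which makes it a rack (each element acts
bijectively and self-distributivity holds), and the projection `c → c/c'` is a
surjective rack homomorphism. -/
theorem stmt_3 {c : Type*} [Fintype c] [Rack c] (c' : Set c)
    (hact : ∀ x ∈ c', ∀ y ∈ c', Shelf.act x y ∈ c')
    (hinv : ∀ x ∈ c', ∀ y ∈ c', Rack.invAct x y ∈ c')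
    (hnormal : ∀ (x : c), ∀ y ∈ c', Shelf.act x y ∈ c') :
    ∃ act : Quot (quotRel c') → Quot (quotRel c') → Quot (quotRel c'),
      (∀ x y : c,
        act (Quot.mk (quotRel c') x) (Quot.mk (quotRel c') y)
          = Quot.mk (quotRel c') (Shelf.act x y)) ∧
      (∀ q : Quot (quotRel c'), Function.Bijective (act q)) ∧
      (∀ a b d : Quot (quotRel c'), act a (act b d) = act (act a b) (act a d)) ∧
      Function.Surjective (Quot.mk (quotRel c')) := by
  let act : Quot (quotRel c') → Quot (quotRel c') → Quot (quotRel c') :=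
    Quot.lift
      (fun x => Quot.map (Shelf.act x) fun _ _ h => quotRel_act_left (hnormal x) h)
      (fun x _ h => funext fun q => Quot.inductionOn q fun z =>
        quot_mk_act_eq_of_quotRel z (hnormal x) h)
  refine ⟨act, fun _ _ => rfl, ?_, ?_, Quot.mk_surjective⟩
  · rintro ⟨x⟩
    refine Function.bijective_iff_has_inverse.2 ⟨Quot.map (Rack.invAct x) fun _ _ h =>
      quotRel_invAct_left (fun _ hw => Rack.invAct_mem_of_act_mem (hnormal x) hw) h, ?_, ?_⟩
    · rintro ⟨y⟩
      exact congrArg (Quot.mk _) (Rack.invAct_act_eq x y)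
    · rintro ⟨y⟩
      exact congrArg (Quot.mk _) (Rack.act_invAct_eq x y)
  · rintro ⟨x⟩ ⟨y⟩ ⟨z⟩
    exact congrArg (Quot.mk _) Shelf.self_distrib
end

section
/- Let c be a finite rack and c' ⊆ c a subrack which is not a union of components of c. Then N_c(c') ≠ c; that is, there exist x ∈ c and y ∈ c' with x ▷ y ∉ c'. -/
/-- A subset of a finite type preserved by a set of permutations is preserved by the subgroup
they generate. -/
theorem Equiv.Perm.mapsTo_of_mem_closure {α : Type*} [Finite α] {S : Set (Equiv.Perm α)}
    {s : Set α} (hS : ∀ f ∈ S, Set.MapsTo f s s) {g : Equiv.Perm α}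
    (hg : g ∈ Subgroup.closure S) : Set.MapsTo g s s := by
  rw [← Subgroup.mem_toSubmonoid, Subgroup.closure_toSubmonoid_of_finite] at hg
  induction hg using Submonoid.closure_induction with
  | mem f hf => exact hS f hf
  | one => exact Set.mapsTo_id s
  | mul f g _ _ hf hg => exact hf.comp hg

/-- Let `c` be a finite rack and `c' ⊆ c` a subrack which is not a union of components
of `c` (i.e. `c'` is not closed under the action of the subgroup of permutations of `c`
generated by the bijections `x ◃ -`).  Then `N_c(c') ≠ c`; that is, there exist
`x ∈ c` and `y ∈ c'` with `x ◃ y ∉ c'`. -/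
theorem stmt_4 {c : Type*} [Fintype c] [Rack c] (c' : Set c)
    (hact : ∀ x ∈ c', ∀ y ∈ c', Shelf.act x y ∈ c')
    (hinv : ∀ x ∈ c', ∀ y ∈ c', Rack.invAct x y ∈ c')
    (hnotunion : ¬ ∀ x ∈ c', ∀ g ∈ Subgroup.closure
        (Set.range (Rack.act' : c → Equiv.Perm c)), (g : Equiv.Perm c) x ∈ c') :
    rackNormalizer c' ≠ Set.univ ∧ ∃ x : c, ∃ y ∈ c', Shelf.act x y ∉ c' := by
  have hmoved : ∃ x : c, ∃ y ∈ c', Shelf.act x y ∉ c' := by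
    by_contra! hnormal
    refine hnotunion fun y hy g hg => Equiv.Perm.mapsTo_of_mem_closure ?_ hg hy
    rintro _ ⟨x, rfl⟩ z hz
    exact hnormal x z hz
  refine ⟨fun huniv => ?_, hmoved⟩
  obtain ⟨x, y, hy, hxy⟩ := hmoved
  have hx : x ∈ rackNormalizer c' := huniv ▸ Set.mem_univ x
  exact hxy (hx y hy)
end

section
/- Let c be a rack and x ∈ c. The assignment sending a word w₁⋯w_k over c to the word (x ▷ w₁)⋯(x ▷ w_k) induces a well-defined monoid automorphism Φ_x of M(c), and for every w ∈ M(c) one has w · [x] = [x] · Φ_x(w) in M(c). -/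
/-- The Hurwitz-move relation on words over a rack `c`: `a · b ∼ b · (b ◃ a)`.
The monoid `M(c) = π₀(Hur^c)` is the quotient of the free monoid on `c` by the
congruence generated by this relation. -/
def hurRel (c : Type*) [Rack c] : FreeMonoid c → FreeMonoid c → Prop :=
  fun u v => ∃ a b : c,
    u = FreeMonoid.of a * FreeMonoid.of b ∧
      v = FreeMonoid.of b * FreeMonoid.of (Shelf.act b a)

/-- The monoid homomorphism induced on Hurwitz monoids by a homomorphism of racks. -/
def hurMap {c d : Type*} [Rack c] [Rack d] (f : ShelfHom c d) :
    (conGen (hurRel c)).Quotient →* (conGen (hurRel d)).Quotient :=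
  (conGen (hurRel c)).lift ((conGen (hurRel d)).mk'.comp (FreeMonoid.map f)) <| by
    refine Con.conGen_le.2 ?_
    rintro _ _ ⟨a, b, rfl, rfl⟩
    refine (Con.eq _).2 (ConGen.Rel.of _ _ ⟨f a, f b, ?_, ?_⟩)
    · simp
    · simp [ShelfHom.map_act]

@[simp]
theorem hurMap_mk' {c d : Type*} [Rack c] [Rack d] (f : ShelfHom c d) (w : FreeMonoid c) :
    hurMap f ((conGen (hurRel c)).mk' w) = (conGen (hurRel d)).mk' (FreeMonoid.map f w) :=
  rfl

theorem hurMap_leftInverse {c d : Type*} [Rack c] [Rack d] {f : ShelfHom c d}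
    {g : ShelfHom d c} (h : Function.LeftInverse g f) :
    Function.LeftInverse (hurMap g) (hurMap f) := by
  intro w
  obtain ⟨w, rfl⟩ := Con.mk'_surjective w
  have hgf : (g : d → c) ∘ f = id := h.comp_eq_id
  rw [hurMap_mk', hurMap_mk', FreeMonoid.map_map, hgf, FreeMonoid.map_id, MonoidHom.id_apply]

/-- The left action of an element of a rack, as a rack endomorphism. -/
def Rack.actHom {c : Type*} [Rack c] (x : c) : ShelfHom c c where
  toFun := Shelf.act x
  map_act' := Shelf.self_distrib

/-- The inverse of the left action of an element of a rack, as a rack endomorphism. -/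
def Rack.invActHom {c : Type*} [Rack c] (x : c) : ShelfHom c c where
  toFun := Rack.invAct x
  map_act' {y z} := by
    rw [← Rack.left_cancel x, Shelf.self_distrib]
    simp only [Rack.act_invAct_eq]

/-- The automorphism of the Hurwitz monoid given by acting letterwise by an element of the rack. -/
def hurActEquiv {c : Type*} [Rack c] (x : c) :
    (conGen (hurRel c)).Quotient ≃* (conGen (hurRel c)).Quotient where
  toFun := hurMap (Rack.actHom x)
  invFun := hurMap (Rack.invActHom x)
  left_inv := hurMap_leftInverse (Rack.left_inv x)
  right_inv := hurMap_leftInverse (Rack.right_inv x)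
  map_mul' := map_mul _

theorem hurActEquiv_mk' {c : Type*} [Rack c] (x : c) (w : FreeMonoid c) :
    hurActEquiv x ((conGen (hurRel c)).mk' w) =
      (conGen (hurRel c)).mk' (FreeMonoid.map (fun a => Shelf.act x a) w) :=
  rfl

theorem mk'_of_mul_mk'_of {c : Type*} [Rack c] (a x : c) :
    (conGen (hurRel c)).mk' (FreeMonoid.of a) * (conGen (hurRel c)).mk' (FreeMonoid.of x) =
      (conGen (hurRel c)).mk' (FreeMonoid.of x) *
        (conGen (hurRel c)).mk' (FreeMonoid.of (Shelf.act x a)) :=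
  (Con.eq _).2 (ConGen.Rel.of _ _ ⟨a, x, rfl, rfl⟩)

theorem mul_mk'_of {c : Type*} [Rack c] (x : c) (w : (conGen (hurRel c)).Quotient) :
    w * (conGen (hurRel c)).mk' (FreeMonoid.of x) =
      (conGen (hurRel c)).mk' (FreeMonoid.of x) * hurActEquiv x w := by
  obtain ⟨w, rfl⟩ := Con.mk'_surjective w
  induction w using FreeMonoid.inductionOn' with
  | one => simp
  | of_mul a w ih =>
    rw [map_mul, mul_assoc, ih, ← mul_assoc, mk'_of_mul_mk'_of, mul_assoc, map_mul,
      hurActEquiv_mk' x (FreeMonoid.of a), FreeMonoid.map_of]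

/-- For a rack `c` and `x ∈ c`, the letterwise assignment `w₁⋯w_k ↦ (x ◃ w₁)⋯(x ◃ w_k)`
induces a monoid automorphism `Φ_x` of `M(c)`, and `w · [x] = [x] · Φ_x(w)` for every
`w ∈ M(c)`. -/
theorem stmt_7 {c : Type*} [Rack c] (x : c) :
    ∃ Φ : (conGen (hurRel c)).Quotient ≃* (conGen (hurRel c)).Quotient,
      (∀ w : FreeMonoid c,
        Φ ((conGen (hurRel c)).mk' w)
          = (conGen (hurRel c)).mk' (FreeMonoid.map (fun a => Shelf.act x a) w)) ∧
      (∀ w : (conGen (hurRel c)).Quotient,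
        w * (conGen (hurRel c)).mk' (FreeMonoid.of x)
          = (conGen (hurRel c)).mk' (FreeMonoid.of x) * Φ w) := by
  exact ⟨hurActEquiv x, hurActEquiv_mk' x, mul_mk'_of x⟩
end

section
/- Let c be a finite rack and c' ⊆ c a normal subrack, and let π : M(c) → M(c/c') be the induced monoid homomorphism. If u, v ∈ M(c) satisfy π(u) = π(v), then there exist words a and b all of whose letters lie in c' such that u · [a] = v · [b] in M(c). (This is a denominator-free form of the paper's statement that there is some w in the localization π₀Hur^{c'}[α_{c'}⁻¹] with u·w = v.) -/
/-- The Hurwitz-move relation `a · b ∼ b · (b ▷ a)` on words over a set `d` equipped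
with a binary operation `act`.  The monoid `M(d)` is the quotient of the free monoid
on `d` by the congruence generated by this relation. -/
def hurRelOp {d : Type*} (act : d → d → d) : FreeMonoid d → FreeMonoid d → Prop :=
  fun u v => ∃ a b : d,
    u = FreeMonoid.of a * FreeMonoid.of b ∧
      v = FreeMonoid.of b * FreeMonoid.of (act b a)

/-- In a monoid with a submonoid `N` satisfying `N m ⊆ m N` for all `m`, elements that agree
after right multiplication by elements of `N` are congruent. -/
def rightMulCon {M : Type*} [Monoid M] (N : Submonoid M)
    (hN : ∀ n ∈ N, ∀ m : M, ∃ n' ∈ N, n * m = m * n') : Con M where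
  r u v := ∃ a ∈ N, ∃ b ∈ N, u * a = v * b
  iseqv :=
    { refl := fun _ => ⟨1, N.one_mem, 1, N.one_mem, rfl⟩
      symm := fun ⟨a, ha, b, hb, h⟩ => ⟨b, hb, a, ha, h.symm⟩
      trans := by
        rintro u v w ⟨a, ha, b, hb, h⟩ ⟨a', ha', b', hb', h'⟩
        obtain ⟨d, hd, hbd⟩ := hN b hb a'
        refine ⟨a * a', N.mul_mem ha ha', b' * d, N.mul_mem hb' hd, ?_⟩
        rw [← mul_assoc, h, mul_assoc, hbd, ← mul_assoc, h', mul_assoc] }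
  mul' := by
    rintro u v x y ⟨a, ha, b, hb, h⟩ ⟨a', ha', b', hb', h'⟩
    obtain ⟨d, hd, had⟩ := hN a ha (x * a')
    obtain ⟨e, he, hbe⟩ := hN b hb (x * a')
    refine ⟨a' * d, N.mul_mem ha' hd, b' * e, N.mul_mem hb' he, ?_⟩
    calc u * x * (a' * d) = u * (x * a' * d) := by simp only [mul_assoc]
      _ = u * a * (x * a') := by rw [← had, mul_assoc]
      _ = v * (x * a' * e) := by rw [h, mul_assoc, hbe]
      _ = v * y * (b' * e) := by rw [h']; simp only [mul_assoc]

/-- The Hurwitz relation in the quotient monoid. -/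
theorem hur_mk_mul {d : Type*} (act : d → d → d) (a b : d) :
    (conGen (hurRelOp act)).mk' (FreeMonoid.of a) * (conGen (hurRelOp act)).mk' (FreeMonoid.of b)
      = (conGen (hurRelOp act)).mk' (FreeMonoid.of b)
        * (conGen (hurRelOp act)).mk' (FreeMonoid.of (act b a)) := by
  rw [← map_mul, ← map_mul]
  exact (Con.eq _).2 (ConGen.Rel.of _ _ ⟨a, b, rfl, rfl⟩)

/-- Classes of words all of whose letters lie in `s`. -/
def lettersSubmonoid {d : Type*} (act : d → d → d) (s : Set d) :
    Submonoid (conGen (hurRelOp act)).Quotient :=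
  Submonoid.closure ((fun x => (conGen (hurRelOp act)).mk' (FreeMonoid.of x)) '' s)

theorem exists_word_of_mem_lettersSubmonoid {d : Type*} {act : d → d → d} {s : Set d}
    {n : (conGen (hurRelOp act)).Quotient} (hn : n ∈ lettersSubmonoid act s) :
    ∃ a : FreeMonoid d, (∀ x ∈ FreeMonoid.toList a, x ∈ s) ∧
      (conGen (hurRelOp act)).mk' a = n := by
  induction hn using Submonoid.closure_induction with
  | mem _ h =>
    obtain ⟨x, hx, rfl⟩ := h
    exact ⟨FreeMonoid.of x, by simpa using hx, rfl⟩
  | one => exact ⟨1, by simp, map_one _⟩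
  | mul _ _ _ _ h₁ h₂ =>
    obtain ⟨a, ha, rfl⟩ := h₁
    obtain ⟨b, hb, rfl⟩ := h₂
    refine ⟨a * b, fun x hx => ?_, map_mul _ _ _⟩
    rw [FreeMonoid.toList_mul, List.mem_append] at hx
    exact hx.elim (ha x) (hb x)

theorem lettersSubmonoid_mul_comm {d : Type*} {act : d → d → d} {s : Set d}
    (hs : ∀ x, ∀ y ∈ s, act x y ∈ s) :
    ∀ n ∈ lettersSubmonoid act s, ∀ m : (conGen (hurRelOp act)).Quotient,
      ∃ n' ∈ lettersSubmonoid act s, n * m = m * n' := by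
  intro n hn m
  obtain ⟨w, rfl⟩ := Con.mk'_surjective m
  induction w using FreeMonoid.inductionOn' generalizing n with
  | one => exact ⟨n, hn, by rw [map_one, mul_one, one_mul]⟩
  | of_mul x w ih =>
    have hx : ∃ n' ∈ lettersSubmonoid act s,
        n * (conGen (hurRelOp act)).mk' (FreeMonoid.of x)
          = (conGen (hurRelOp act)).mk' (FreeMonoid.of x) * n' := by
      induction hn using Submonoid.closure_induction with
      | mem _ h =>
        obtain ⟨y, hy, rfl⟩ := h
        exact ⟨_, Submonoid.subset_closure ⟨act x y, hs x y hy, rfl⟩, hur_mk_mul act y x⟩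
      | one => exact ⟨1, Submonoid.one_mem _, by rw [one_mul, mul_one]⟩
      | mul _ _ _ _ h₁ h₂ =>
        obtain ⟨p, hp, hp'⟩ := h₁
        obtain ⟨q, hq, hq'⟩ := h₂
        exact ⟨p * q, Submonoid.mul_mem _ hp hq, by
          rw [mul_assoc, hq', ← mul_assoc, hp', mul_assoc]⟩
    obtain ⟨n₁, hn₁, h₁⟩ := hx
    obtain ⟨n₂, hn₂, h₂⟩ := ih n₁ hn₁
    exact ⟨n₂, hn₂, by rw [map_mul, ← mul_assoc, h₁, mul_assoc, h₂, mul_assoc]⟩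

/-- Let `c` be a finite rack, `c' ⊆ c` a normal subrack, `c/c'` the quotient rack (with
operation `qact` satisfying `x̄ ▷ ȳ = (x ▷ y)‾`), and `π : M(c) →* M(c/c')` the induced
monoid homomorphism (determined by `π [x] = [x̄]`).  If `π u = π v`, then there exist
words `a`, `b` all of whose letters lie in `c'` with `u · [a] = v · [b]` in `M(c)`. -/
theorem stmt_9 {c : Type*} [Fintype c] [Rack c] (c' : Set c)
    (hact : ∀ x ∈ c', ∀ y ∈ c', Shelf.act x y ∈ c')
    (hinv : ∀ x ∈ c', ∀ y ∈ c', Rack.invAct x y ∈ c')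
    (hnormal : ∀ (x : c), ∀ y ∈ c', Shelf.act x y ∈ c')
    (qact : Quot (quotRel c') → Quot (quotRel c') → Quot (quotRel c'))
    (hqact : ∀ x y : c,
      qact (Quot.mk (quotRel c') x) (Quot.mk (quotRel c') y)
        = Quot.mk (quotRel c') (Shelf.act x y))
    (π : (conGen (hurRelOp (Shelf.act : c → c → c))).Quotient →*
      (conGen (hurRelOp qact)).Quotient)
    (hπ : ∀ x : c,
      π ((conGen (hurRelOp (Shelf.act : c → c → c))).mk' (FreeMonoid.of x))
        = (conGen (hurRelOp qact)).mk' (FreeMonoid.of (Quot.mk (quotRel c') x)))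
    (u v : (conGen (hurRelOp (Shelf.act : c → c → c))).Quotient)
    (huv : π u = π v) :
    ∃ a b : FreeMonoid c,
      (∀ x ∈ FreeMonoid.toList a, x ∈ c') ∧
      (∀ x ∈ FreeMonoid.toList b, x ∈ c') ∧
      u * (conGen (hurRelOp (Shelf.act : c → c → c))).mk' a
        = v * (conGen (hurRelOp (Shelf.act : c → c → c))).mk' b := by
  have hN := lettersSubmonoid_mul_comm (act := (Shelf.act : c → c → c)) hnormal
  let K := conGen (hurRelOp (Shelf.act : c → c → c))
  let R := rightMulCon _ hN
  let g : Quot (quotRel c') → R.Quotient :=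
    Quot.lift (fun x => R.mk' (K.mk' (FreeMonoid.of x))) <| by
      rintro x _ ⟨w, hw, rfl⟩
      refine (Con.eq R).2 ⟨_, Submonoid.subset_closure ⟨w, hw, rfl⟩,
        _, Submonoid.subset_closure ⟨_, hnormal (Shelf.act w x) w hw, rfl⟩, ?_⟩
      exact (hur_mk_mul _ x w).trans (hur_mk_mul _ w (Shelf.act w x))
  have hg : conGen (hurRelOp qact) ≤ Con.ker (FreeMonoid.lift g) := by
    refine Con.conGen_le.2 ?_
    rintro _ _ ⟨⟨a⟩, ⟨b⟩, rfl, rfl⟩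
    rw [Con.ker_rel, hqact]
    simp only [map_mul, FreeMonoid.lift_eval_of]
    exact (map_mul R.mk' _ _).symm.trans
      ((congrArg R.mk' (hur_mk_mul _ a b)).trans (map_mul R.mk' _ _))
  let ψ := Con.lift _ (FreeMonoid.lift g) hg
  have hψ : (ψ.comp π).comp K.mk' = R.mk'.comp K.mk' := by
    refine FreeMonoid.hom_eq fun x => ?_
    change ψ (π (K.mk' (FreeMonoid.of x))) = _
    rw [hπ]
    exact (Con.lift_mk' hg _).trans (FreeMonoid.lift_eval_of g (Quot.mk _ x))
  have key : ∀ m, ψ (π m) = R.mk' m := fun m => by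
    obtain ⟨w, rfl⟩ := Con.mk'_surjective m
    exact DFunLike.congr_fun hψ w
  have huv' : R.mk' u = R.mk' v := by rw [← key, ← key, huv]
  obtain ⟨a, ha, b, hb, h⟩ := (Con.eq R).1 huv'
  obtain ⟨a, ha', rfl⟩ := exists_word_of_mem_lettersSubmonoid ha
  obtain ⟨b, hb', rfl⟩ := exists_word_of_mem_lettersSubmonoid hb
  exact ⟨a, b, ha', hb', h⟩
end

section
/- Let c be a finite rack and c' ⊆ c a normal subrack. The monoid homomorphism π : M(c) → M(c/c') is surjective and is 'module surjective': for every m ∈ M(c) and every factorization π(m) = x · n with x, n ∈ M(c/c'), there exist x̃, ñ ∈ M(c) with π(x̃) = x, π(ñ) = n and m = x̃ · ñ. -/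
/-- Splitting a word along a factorization of its image. -/
theorem FreeMonoid.exists_mul_of_map_eq_mul {α β : Type*} (f : α → β) (w : FreeMonoid α)
    (u v : FreeMonoid β) (h : FreeMonoid.map f w = u * v) :
    ∃ p q, w = p * q ∧ FreeMonoid.map f p = u ∧ FreeMonoid.map f q = v := by
  obtain ⟨p, q, hw, hp, hq⟩ := List.map_eq_append_iff.1
    (show List.map f (FreeMonoid.toList w) = FreeMonoid.toList u ++ FreeMonoid.toList v from h)
  exact ⟨FreeMonoid.ofList p, FreeMonoid.ofList q, hw, hp, hq⟩

/-- A word whose image is a letter is a letter. -/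
theorem FreeMonoid.exists_of_map_eq_of {α β : Type*} (f : α → β) (w : FreeMonoid α) (b : β)
    (h : FreeMonoid.map f w = FreeMonoid.of b) : ∃ a, w = FreeMonoid.of a ∧ f a = b := by
  obtain ⟨a, ha, hb⟩ := List.map_eq_singleton_iff.1
    (show List.map f (FreeMonoid.toList w) = [b] from h)
  exact ⟨a, ha, hb⟩

/-- Every lift of `u` along `f` is congruent, modulo `C`, to a lift of `v`. -/
def LiftsAlong {α β : Type*} (f : α → β) (C : Con (FreeMonoid α)) (u v : FreeMonoid β) : Prop :=
  ∀ w, FreeMonoid.map f w = u → ∃ w', FreeMonoid.map f w' = v ∧ C w w'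

theorem LiftsAlong.trans {α β : Type*} {f : α → β} {C : Con (FreeMonoid α)}
    {u v t : FreeMonoid β} (h₁ : LiftsAlong f C u v) (h₂ : LiftsAlong f C v t) :
    LiftsAlong f C u t := by
  intro w hw
  obtain ⟨w', hw', hc⟩ := h₁ w hw
  obtain ⟨w'', hw'', hc'⟩ := h₂ w' hw'
  exact ⟨w'', hw'', C.trans hc hc'⟩

theorem LiftsAlong.mul {α β : Type*} {f : α → β} {C : Con (FreeMonoid α)}
    {u v s t : FreeMonoid β} (h₁ : LiftsAlong f C u v) (h₂ : LiftsAlong f C s t) :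
    LiftsAlong f C (u * s) (v * t) := by
  intro w hw
  obtain ⟨p, q, rfl, hp, hq⟩ := FreeMonoid.exists_mul_of_map_eq_mul f w u s hw
  obtain ⟨p', hp', hcp⟩ := h₁ p hp
  obtain ⟨q', hq', hcq⟩ := h₂ q hq
  exact ⟨p' * q', by rw [map_mul, hp', hq'], C.mul hcp hcq⟩

/-- The congruence on words over `β` given by lifting in both directions. -/
def liftCon {α β : Type*} (f : α → β) (C : Con (FreeMonoid α)) : Con (FreeMonoid β) where
  r u v := LiftsAlong f C u v ∧ LiftsAlong f C v u
  iseqv :=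
    ⟨fun _ => ⟨fun w hw => ⟨w, hw, C.refl w⟩, fun w hw => ⟨w, hw, C.refl w⟩⟩,
      fun h => ⟨h.2, h.1⟩, fun h k => ⟨h.1.trans k.1, k.2.trans h.2⟩⟩
  mul' h k := ⟨h.1.mul k.1, h.2.mul k.2⟩

/-- Hurwitz moves lift along a homomorphism `f` from a rack to a set with an operation
whose left translations by elements of the image are injective. -/
theorem conGen_hurRelOp_le_liftCon {c d : Type*} [Rack c] (f : c → d) (act : d → d → d)
    (hf : ∀ x y, act (f x) (f y) = f (Shelf.act x y))
    (hinj : ∀ x, Function.Injective (act (f x))) :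
    conGen (hurRelOp act) ≤ liftCon f (conGen (hurRelOp (Shelf.act : c → c → c))) := by
  refine Con.conGen_le.2 ?_
  rintro _ _ ⟨a, b, rfl, rfl⟩
  constructor
  · intro w hw
    obtain ⟨p, q, rfl, hp, hq⟩ := FreeMonoid.exists_mul_of_map_eq_mul f w _ _ hw
    obtain ⟨x, rfl, rfl⟩ := FreeMonoid.exists_of_map_eq_of f p _ hp
    obtain ⟨y, rfl, rfl⟩ := FreeMonoid.exists_of_map_eq_of f q _ hq
    exact ⟨FreeMonoid.of y * FreeMonoid.of (Shelf.act y x), by simp [hf],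
      ConGen.Rel.of _ _ ⟨x, y, rfl, rfl⟩⟩
  · intro w hw
    obtain ⟨p, q, rfl, hp, hq⟩ := FreeMonoid.exists_mul_of_map_eq_mul f w _ _ hw
    obtain ⟨y, rfl, rfl⟩ := FreeMonoid.exists_of_map_eq_of f p _ hp
    obtain ⟨z, rfl, hz⟩ := FreeMonoid.exists_of_map_eq_of f q _ hq
    have hact : Shelf.act y (Rack.invAct y z) = z := Rack.right_inv y z
    have ha : f (Rack.invAct y z) = a := hinj y (by rw [hf, hact, hz])
    exact ⟨FreeMonoid.of (Rack.invAct y z) * FreeMonoid.of y, by simp [ha],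
      ConGen.Rel.symm (ConGen.Rel.of _ _ ⟨Rack.invAct y z, y, rfl, by rw [hact]⟩)⟩

/-- Let `c` be a finite rack, `c' ⊆ c` a normal subrack, `c/c'` the quotient rack (with
operation `qact` satisfying `x̄ ▷ ȳ = (x ▷ y)‾`), and `π : M(c) →* M(c/c')` the induced
monoid homomorphism (determined by `π [x] = [x̄]`).  Then `π` is surjective and module
surjective: for every `m ∈ M(c)` and every factorization `π m = x * n` in `M(c/c')`
there exist `x̃, ñ ∈ M(c)` with `π x̃ = x`, `π ñ = n` and `m = x̃ * ñ`. -/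
theorem stmt_10 {c : Type*} [Fintype c] [Rack c] (c' : Set c)
    (hact : ∀ x ∈ c', ∀ y ∈ c', Shelf.act x y ∈ c')
    (hinv : ∀ x ∈ c', ∀ y ∈ c', Rack.invAct x y ∈ c')
    (hnormal : ∀ (x : c), ∀ y ∈ c', Shelf.act x y ∈ c')
    (qact : Quot (quotRel c') → Quot (quotRel c') → Quot (quotRel c'))
    (hqact : ∀ x y : c,
      qact (Quot.mk (quotRel c') x) (Quot.mk (quotRel c') y)
        = Quot.mk (quotRel c') (Shelf.act x y))
    (π : (conGen (hurRelOp (Shelf.act : c → c → c))).Quotient →*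
      (conGen (hurRelOp qact)).Quotient)
    (hπ : ∀ x : c,
      π ((conGen (hurRelOp (Shelf.act : c → c → c))).mk' (FreeMonoid.of x))
        = (conGen (hurRelOp qact)).mk' (FreeMonoid.of (Quot.mk (quotRel c') x))) :
    Function.Surjective π ∧
    ∀ m : (conGen (hurRelOp (Shelf.act : c → c → c))).Quotient,
      ∀ x n : (conGen (hurRelOp qact)).Quotient,
        π m = x * n →
          ∃ xt nt : (conGen (hurRelOp (Shelf.act : c → c → c))).Quotient,
            π xt = x ∧ π nt = n ∧ m = xt * nt := by
  have hinj : ∀ x : c, Function.Injective (qact (Quot.mk (quotRel c') x)) := by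
    intro x
    refine Finite.injective_iff_surjective.2 fun y => ?_
    induction y using Quot.ind with
    | mk y =>
      exact ⟨Quot.mk _ (Rack.invAct x y), by
        rw [hqact, show Shelf.act x (Rack.invAct x y) = y from Rack.right_inv x y]⟩
  have hmap : ∀ w : FreeMonoid c,
      π ((conGen (hurRelOp (Shelf.act : c → c → c))).mk' w)
        = (conGen (hurRelOp qact)).mk' (FreeMonoid.map (Quot.mk (quotRel c')) w) := by
    intro w
    have h : π.comp (conGen (hurRelOp (Shelf.act : c → c → c))).mk'
        = (conGen (hurRelOp qact)).mk'.comp (FreeMonoid.map (Quot.mk (quotRel c'))) :=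
      FreeMonoid.hom_eq fun x => hπ x
    exact DFunLike.congr_fun h w
  constructor
  · intro n
    obtain ⟨v, rfl⟩ := Con.mk'_surjective n
    obtain ⟨w, rfl⟩ := FreeMonoid.map_surjective.2 (Quot.mk_surjective (r := quotRel c')) v
    exact ⟨_, hmap w⟩
  · intro m x n h
    obtain ⟨w, rfl⟩ := Con.mk'_surjective m
    obtain ⟨u, rfl⟩ := Con.mk'_surjective x
    obtain ⟨v, rfl⟩ := Con.mk'_surjective n
    rw [hmap, ← map_mul] at h
    obtain ⟨w', hw', hc⟩ :=
      (conGen_hurRelOp_le_liftCon (Quot.mk (quotRel c')) qact hqact hinj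
        ((Con.eq _).1 h)).1 w rfl
    obtain ⟨p, q, rfl, rfl, rfl⟩ := FreeMonoid.exists_mul_of_map_eq_mul _ w' u v hw'
    exact ⟨_, _, hmap p, hmap q, by rw [← map_mul]; exact (Con.eq _).2 hc⟩
end

section
/- Let c be a finite rack and c' ⊆ c a subrack. Then the normalizer N_c(c') is itself a subrack of c, and it contains c'. -/
/-- An element normalizing a finite subset `c'` of a rack also preserves `c'` under `◃⁻¹`. -/
theorem invAct_mem_of_mem_rackNormalizer {c : Type*} [Rack c] {c' : Set c} (hfin : c'.Finite)
    {x y : c} (hx : x ∈ rackNormalizer c') (hy : y ∈ c') : Rack.invAct x y ∈ c' := by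
  have hinj : Set.InjOn (Shelf.act x) c' := fun a _ b _ h => (Rack.left_cancel x).1 h
  obtain ⟨z, hz, rfl⟩ := ((hfin.injOn_iff_bijOn_of_mapsTo hx).1 hinj).surjOn hy
  rwa [Rack.invAct_act_eq]

/-- Let `c` be a finite rack and `c' ⊆ c` a subrack.  Then the normalizer `N_c(c')` is
itself a subrack of `c` (closed under `◃` and `◃⁻¹`), and it contains `c'`. -/
theorem stmt_11 {c : Type*} [Fintype c] [Rack c] (c' : Set c)
    (hact : ∀ x ∈ c', ∀ y ∈ c', Shelf.act x y ∈ c')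
    (hinv : ∀ x ∈ c', ∀ y ∈ c', Rack.invAct x y ∈ c') :
    (∀ x ∈ rackNormalizer c', ∀ y ∈ rackNormalizer c',
      Shelf.act x y ∈ rackNormalizer c') ∧
    (∀ x ∈ rackNormalizer c', ∀ y ∈ rackNormalizer c',
      Rack.invAct x y ∈ rackNormalizer c') ∧
    c' ⊆ rackNormalizer c' := by
  refine ⟨fun x hx y hy z hz => ?_, fun x hx y hy z hz => ?_, fun x hx y hy => hact x hx y hy⟩
  · have hz' := hx _ (hy _ (invAct_mem_of_mem_rackNormalizer c'.toFinite hx hz))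
    rwa [Shelf.self_distrib, Rack.act_invAct_eq] at hz'
  · have hz' := invAct_mem_of_mem_rackNormalizer c'.toFinite hx (hy _ (hx z hz))
    have h : Shelf.act x (Shelf.act (Rack.invAct x y) z) = Shelf.act y (Shelf.act x z) := by
      rw [Shelf.self_distrib, Rack.act_invAct_eq]
    rwa [← h, Rack.invAct_act_eq] at hz'
end

section
/- The second integral group homology of the alternating group on 4 letters is cyclic of order 2: H₂(A₄; ℤ) ≅ ℤ/2ℤ. -/
/-- The differential of the (inhomogeneous) bar complex computing the group homology
`H_*(G; ℤ)` with trivial coefficients: on the free `ℤ`-module on `Gⁿ⁺¹`,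
`d(g₁,…,g_{n+1}) = (g₂,…,g_{n+1}) + ∑_{i=1}^{n} (−1)^i (g₁,…,g_i g_{i+1},…,g_{n+1})
+ (−1)^{n+1} (g₁,…,g_n)`. -/
noncomputable def barDelta (G : Type*) [Group G] (n : ℕ) :
    ((Fin (n + 1) → G) →₀ ℤ) →ₗ[ℤ] ((Fin n → G) →₀ ℤ) :=
  ∑ j : Fin (n + 2),
    (-1 : ℤ) ^ (j : ℕ) • Finsupp.lmapDomain ℤ ℤ
      (fun (g : Fin (n + 1) → G) (i : Fin n) =>
        if (i : ℕ) + 1 < (j : ℕ) then g i.castSucc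
        else if (i : ℕ) + 1 = (j : ℕ) then g i.castSucc * g i.succ
        else g i.succ)

/-- The second group homology `H₂(G; ℤ)` of `G` with coefficients in the trivial
`G`-module `ℤ`, computed as the homology of the bar complex in degree 2. -/
noncomputable abbrev barH2 (G : Type*) [Group G] :=
  ↥(LinearMap.ker (barDelta G 1)) ⧸
    (LinearMap.range (barDelta G 2)).comap (LinearMap.ker (barDelta G 1)).subtype

/-- Linear extension to bar `2`-chains of a function of two group elements. -/
noncomputable def evalTwo {G A : Type*} [AddCommGroup A] (u : G → G → A) :
    ((Fin 2 → G) →₀ ℤ) →ₗ[ℤ] A :=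
  Finsupp.linearCombination ℤ fun x => u (x 0) (x 1)

theorem evalTwo_single {G A : Type*} [AddCommGroup A] (u : G → G → A) (x : Fin 2 → G) (n : ℤ) :
    evalTwo u (Finsupp.single x n) = n • u (x 0) (x 1) := by
  simp [evalTwo]

theorem barDelta_one_single {G : Type*} [Group G] (x : Fin 2 → G) (n : ℤ) :
    barDelta G 1 (Finsupp.single x n) = Finsupp.single ![x 1] n
      - Finsupp.single ![x 0 * x 1] n + Finsupp.single ![x 0] n := by
  rw [barDelta, LinearMap.sum_apply]
  refine (Fin.sum_univ_three _).trans ?_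
  simp only [LinearMap.smul_apply, Finsupp.lmapDomain_apply, Finsupp.mapDomain_single]
  have h (y : Fin 1 → G) : y = ![y 0] := by ext i; fin_cases i; rfl
  rw [h (fun i => _), h (fun i => _), h (fun i => _)]
  simp [sub_eq_add_neg]

theorem barDelta_two_single {G : Type*} [Group G] (x : Fin 3 → G) (n : ℤ) :
    barDelta G 2 (Finsupp.single x n) = Finsupp.single ![x 1, x 2] n
      - Finsupp.single ![x 0 * x 1, x 2] n + Finsupp.single ![x 0, x 1 * x 2] n
      - Finsupp.single ![x 0, x 1] n := by
  rw [barDelta, LinearMap.sum_apply]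
  refine (Fin.sum_univ_four _).trans ?_
  simp only [LinearMap.smul_apply, Finsupp.lmapDomain_apply, Finsupp.mapDomain_single]
  have h (y : Fin 2 → G) : y = ![y 0, y 1] := by ext i; fin_cases i <;> rfl
  rw [h (fun i => _), h (fun i => _), h (fun i => _), h (fun i => _)]
  simp [sub_eq_add_neg, pow_succ]

/-- The inhomogeneous `2`-cocycle condition for trivial coefficients. -/
def IsTwoCocycle {G A : Type*} [Group G] [AddCommGroup A] (u : G → G → A) : Prop :=
  ∀ g h k, u h k - u (g * h) k + u g (h * k) - u g h = 0

theorem IsTwoCocycle.evalTwo_barDelta {G A : Type*} [Group G] [AddCommGroup A] {u : G → G → A}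
    (hu : IsTwoCocycle u) (w : (Fin 3 → G) →₀ ℤ) : evalTwo u (barDelta G 2 w) = 0 := by
  induction w using Finsupp.induction_linear with
  | zero => simp
  | add x y hx hy => simp [hx, hy]
  | single x n =>
    have := hu (x 0) (x 1) (x 2)
    simp [barDelta_two_single, evalTwo_single, ← smul_sub, ← smul_add, this]

theorem isTwoCocycle_single {G A : Type*} [Group G] [AddCommGroup A]
    (φ : ((Fin 2 → G) →₀ ℤ) →ₗ[ℤ] A) (hφ : ∀ w, φ (barDelta G 2 w) = 0) :
    IsTwoCocycle fun g h => φ (Finsupp.single ![g, h] 1) := by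
  intro g h k
  simpa [barDelta_two_single] using hφ (Finsupp.single ![g, h, k] 1)

theorem evalTwo_coboundary {G A : Type*} [Group G] [AddCommGroup A] (ψ : G → A)
    (z : (Fin 2 → G) →₀ ℤ) :
    evalTwo (fun g h => ψ h - ψ (g * h) + ψ g) z =
      Finsupp.linearCombination ℤ (fun x : Fin 1 → G => ψ (x 0)) (barDelta G 1 z) := by
  induction z using Finsupp.induction_linear with
  | zero => simp
  | add x y hx hy => simp [hx, hy]
  | single x n => simp [barDelta_one_single, evalTwo_single, smul_add, smul_sub]

/-- The central extension of `G` by `A` classified by a `2`-cocycle. -/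
@[ext]
structure CocycleExtension {G A : Type*} [Group G] [AddCommGroup A] (u : G → G → A)
    (hu : IsTwoCocycle u) where
  coeff : A
  base : G

namespace CocycleExtension

variable {G A : Type*} [Group G] [AddCommGroup A] {u : G → G → A} {hu : IsTwoCocycle u}

theorem cocycle_one_left (hu : IsTwoCocycle u) (g : G) : u 1 g = u 1 1 := by
  simpa [sub_eq_zero] using hu 1 1 g

theorem cocycle_one_right (hu : IsTwoCocycle u) (g : G) : u g 1 = u 1 1 := by
  simpa [sub_eq_zero, eq_comm] using hu g 1 1

instance : Mul (CocycleExtension u hu) :=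
  ⟨fun x y => ⟨x.coeff + y.coeff + u x.base y.base, x.base * y.base⟩⟩

instance : One (CocycleExtension u hu) := ⟨⟨-u 1 1, 1⟩⟩

instance : Inv (CocycleExtension u hu) :=
  ⟨fun x => ⟨-x.coeff - u x.base⁻¹ x.base - u 1 1, x.base⁻¹⟩⟩

@[simp] theorem coeff_mul (x y : CocycleExtension u hu) :
    (x * y).coeff = x.coeff + y.coeff + u x.base y.base := rfl
@[simp] theorem base_mul (x y : CocycleExtension u hu) : (x * y).base = x.base * y.base := rfl
@[simp] theorem coeff_one : (1 : CocycleExtension u hu).coeff = -u 1 1 := rfl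
@[simp] theorem base_one : (1 : CocycleExtension u hu).base = 1 := rfl
@[simp] theorem coeff_inv (x : CocycleExtension u hu) :
    (x⁻¹).coeff = -x.coeff - u x.base⁻¹ x.base - u 1 1 := rfl
@[simp] theorem base_inv (x : CocycleExtension u hu) : (x⁻¹).base = x.base⁻¹ := rfl

instance : Group (CocycleExtension u hu) :=
  Group.ofLeftAxioms
    (fun x y z => by
      ext
      · have := hu x.base y.base z.base
        simp only [coeff_mul, base_mul]
        rw [← sub_eq_zero, ← neg_eq_zero, ← this]
        abel
      · simp [mul_assoc])
    (fun x => by ext <;> simp [cocycle_one_left hu])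
    (fun x => by ext <;> simp; abel)

/-- The projection of the extension onto its quotient. -/
@[simps]
def proj (hu : IsTwoCocycle u) : CocycleExtension u hu →* G where
  toFun := base
  map_one' := rfl
  map_mul' _ _ := rfl

theorem proj_surjective : Function.Surjective (proj hu) := fun g => ⟨⟨0, g⟩, rfl⟩

/-- The inclusion of the kernel of the extension. -/
@[simps]
def incl (hu : IsTwoCocycle u) : Multiplicative A →* CocycleExtension u hu where
  toFun a := ⟨a.toAdd - u 1 1, 1⟩
  map_one' := by ext <;> simp
  map_mul' a b := by ext <;> simp; abel

theorem exists_incl_eq {x : CocycleExtension u hu} (hx : x ∈ (proj hu).ker) :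
    ∃ a, incl hu (.ofAdd a) = x :=
  ⟨x.coeff + u 1 1, by ext <;> simp [show x.base = 1 from hx]⟩

theorem incl_injective : Function.Injective (incl hu) := fun a b h => by
  simpa using congrArg coeff h

theorem ker_proj_le_center : (proj hu).ker ≤ Subgroup.center (CocycleExtension u hu) := by
  intro x hx
  have hx : x.base = 1 := hx
  rw [Subgroup.mem_center_iff]
  intro y
  ext
  · simp [hx, cocycle_one_left hu, cocycle_one_right hu, add_comm]
  · simp [hx]

end CocycleExtension

open Equiv

/-- Signs in the multiplication table of the quaternion units `1, i, j, k`. -/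
def quaternionSign : Fin 4 → Fin 4 → ZMod 2 :=
  ![![0, 0, 0, 0], ![0, 1, 0, 1], ![0, 1, 1, 0], ![0, 0, 1, 1]]

namespace AlternatingFour

/-- The `2`-cocycle classifying the binary tetrahedral group. It uses the identification, given by
the orbit of `0`, of the Klein subgroup with `Fin 4` under bitwise exclusive or. -/
def tetrahedralCocycle (g h : alternatingGroup (Fin 4)) : ZMod 2 :=
  quaternionSign (g.1 0) (g.1 0 ^^^ g.1 (h.1 0))

theorem isTwoCocycle_tetrahedralCocycle : IsTwoCocycle tetrahedralCocycle := by
  have key : ∀ (g : alternatingGroup (Fin 4)) (a b : Fin 4),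
      quaternionSign a (a ^^^ b) - quaternionSign (g.1 a) (g.1 a ^^^ g.1 b)
        + quaternionSign (g.1 0) (g.1 0 ^^^ g.1 b)
        - quaternionSign (g.1 0) (g.1 0 ^^^ g.1 a) = 0 := by decide +kernel
  exact fun g h k => key g (h.1 0) (h.1 (k.1 0))

/-- The rotation `(1 2 3)`. -/
def rotation : alternatingGroup (Fin 4) :=
  ⟨swap 1 2 * swap 2 3, Perm.mem_alternatingGroup.mpr (by decide)⟩

/-- The element of the Klein subgroup moving `0` to a given point. -/
def klein : Fin 4 → alternatingGroup (Fin 4) :=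
  ![1, ⟨swap 0 1 * swap 2 3, Perm.mem_alternatingGroup.mpr (by decide)⟩,
    ⟨swap 0 2 * swap 1 3, Perm.mem_alternatingGroup.mpr (by decide)⟩,
    ⟨swap 0 3 * swap 1 2, Perm.mem_alternatingGroup.mpr (by decide)⟩]

/-- The exponent of `rotation` in the image of `g` modulo the Klein subgroup. -/
def rotationIndex (g : alternatingGroup (Fin 4)) : ℕ := ((g.1 0 ^^^ g.1 1) - 1 : Fin 4).val

theorem klein_mul_rotation_pow :
    ∀ g, klein (g.1 0) * rotation ^ rotationIndex g = g := by decide +kernel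

theorem rotation_pow_apply :
    ∀ (g : alternatingGroup (Fin 4)) (a : Fin 4),
      (rotation ^ rotationIndex g).1 a = g.1 0 ^^^ g.1 a := by decide +kernel

theorem rotationIndex_mul :
    ∀ g h, rotationIndex (g * h) = (rotationIndex g + rotationIndex h) % 3 := by decide +kernel

/-- A central extension of `A₄` whose kernel admits cube roots has a section whose defect is an
image of `tetrahedralCocycle`: the Klein subgroup lifts to quaternion units, permuted cyclically
by a lift of order three of `rotation`. -/
theorem exists_quaternion_section {E : Type*} [Group E] (π : E →* alternatingGroup (Fin 4))
    (hπ : Function.Surjective π) (hc : π.ker ≤ Subgroup.center E)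
    (hroot : ∀ k ∈ π.ker, ∃ x ∈ π.ker, x ^ 3 = k) :
    ∃ (σ : alternatingGroup (Fin 4) → E) (τ : E), τ ∈ π.ker ∧ τ ^ 2 = 1 ∧ (∀ g, π (σ g) = g) ∧
      ∀ g h, σ g * σ h = τ ^ (tetrahedralCocycle g h).val * σ (g * h) := by
  have comm {k : E} (hk : k ∈ π.ker) (x : E) : x * k = k * x :=
    Subgroup.mem_center_iff.mp (hc hk) x
  obtain ⟨W, hW, hW3⟩ : ∃ W, π W = rotation ∧ W ^ 3 = 1 := by
    obtain ⟨W, hW⟩ := hπ rotation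
    obtain ⟨x, hx, hx3⟩ := hroot (W ^ 3) (by
      rw [MonoidHom.mem_ker, map_pow, hW]; decide +kernel)
    refine ⟨W * x⁻¹, by simp [hW, MonoidHom.mem_ker.mp hx], ?_⟩
    rw [Commute.mul_pow (comm (inv_mem hx) W), inv_pow, hx3, mul_inv_cancel]
  obtain ⟨X, hX, hXYZ⟩ : ∃ X, π X = klein 1 ∧
      X * (W * X * W⁻¹) = W * (W * X * W⁻¹) * W⁻¹ := by
    obtain ⟨X, hX⟩ := hπ (klein 1)
    obtain ⟨β, hβ⟩ : ∃ β, X * (W * X * W⁻¹) = β * (W * (W * X * W⁻¹) * W⁻¹) :=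
      ⟨X * (W * X * W⁻¹) * (W * (W * X * W⁻¹) * W⁻¹)⁻¹, by group⟩
    have hβk : β ∈ π.ker := by
      have h := congrArg π hβ
      simp only [map_mul, map_inv, hX, hW] at h
      have h' : klein 1 * (rotation * klein 1 * rotation⁻¹) =
        1 * (rotation * (rotation * klein 1 * rotation⁻¹) * rotation⁻¹) := by decide +kernel
      exact (mul_right_cancel (h'.symm.trans h)).symm
    have hi := inv_mem hβk
    have e1 : W * (β⁻¹ * X) * W⁻¹ = β⁻¹ * (W * X * W⁻¹) := by
      rw [← mul_assoc W, comm hi W]; group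
    have e2 (T : E) : W * (β⁻¹ * T) * W⁻¹ = β⁻¹ * (W * T * W⁻¹) := by
      rw [← mul_assoc W, comm hi W]; group
    refine ⟨β⁻¹ * X, by simp [hX, MonoidHom.mem_ker.mp hβk], ?_⟩
    rw [e2, e2, mul_assoc, ← mul_assoc X, comm hi X, mul_assoc, hβ]
    group
  obtain ⟨Y, hY⟩ : ∃ Y, Y = W * X * W⁻¹ := ⟨_, rfl⟩
  obtain ⟨Z, hZ⟩ : ∃ Z, Z = W * Y * W⁻¹ := ⟨_, rfl⟩
  have conjX : W * X = Y * W := by rw [hY]; group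
  have conjY : W * Y = Z * W := by rw [hZ]; group
  have conjZ : W * Z = X * W := by
    rw [hZ, hY]
    calc _ = W ^ 3 * X * (W ^ 3)⁻¹ * W := by simp [pow_succ, mul_assoc]
      _ = X * W := by simp [hW3]
  have hXY : X * Y = Z := by rw [hZ, hY]; exact hXYZ
  have conj_mul {a b c a' b' c' : E} (ha : W * a = a' * W) (hb : W * b = b' * W)
      (hc : W * c = c' * W) (h : a * b = c) : a' * b' = c' := by
    apply mul_right_cancel (b := W)
    rw [mul_assoc, ← hb, ← mul_assoc, ← ha, mul_assoc, h, hc]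
  have hYZ : Y * Z = X := conj_mul conjX conjY conjZ hXY
  have hZX : Z * X = Y := conj_mul conjY conjZ conjX hYZ
  obtain ⟨τ, hτ⟩ : ∃ τ, τ = X * X := ⟨_, rfl⟩
  have hτk : τ ∈ π.ker := by
    rw [MonoidHom.mem_ker, hτ, map_mul, hX]; decide +kernel
  have hXX : X * X = τ := hτ.symm
  have hYY : Y * Y = τ := conj_mul conjX conjX (comm hτk W) hXX
  have hZZ : Z * Z = τ := conj_mul conjY conjY (comm hτk W) hYY
  have hYX' : τ * (Y * X) = Z := by
    calc τ * (Y * X) = Y * X * τ := (comm hτk _).symm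
      _ = Y * (X * Y) * Y := by rw [← hYY]; group
      _ = Z := by rw [hXY, hYZ, hXY]
  have hττ : τ * τ = 1 := by
    have : τ * (Y * X) * (τ * (Y * X)) = τ := by rw [hYX', hZZ]
    have h2 : Y * X * (Y * X) = τ := by
      calc Y * X * (Y * X) = Y * (X * Y) * X := by group
        _ = τ := by rw [hXY, hYZ, hXX]
    have h3 : τ * (Y * X) * (τ * (Y * X)) = τ * τ * τ := by
      rw [mul_assoc τ, ← mul_assoc (Y * X), comm hτk (Y * X), mul_assoc τ, h2, mul_assoc]
    exact mul_right_cancel (b := τ) (by rw [← h3, this, one_mul])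
  have hYX : Y * X = τ * Z := by rw [← hYX', ← mul_assoc, hττ, one_mul]
  have hZY : Z * Y = τ * X :=
    conj_mul conjY conjX (c' := τ * X)
      (by rw [← mul_assoc, comm hτk W, mul_assoc, conjZ, mul_assoc])
      hYX
  have hXZ : X * Z = τ * Y :=
    conj_mul conjZ conjY (c' := τ * Y)
      (by rw [← mul_assoc, comm hτk W, mul_assoc, conjX, mul_assoc])
      hZY
  let Q : Fin 4 → E := ![1, X, Y, Z]
  have hQ (a : Fin 4) : π (Q a) = klein a := by
    fin_cases a
    · exact map_one π
    · exact hX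
    · change π Y = _
      rw [hY, map_mul, map_mul, map_inv, hX, hW]; decide +kernel
    · change π Z = _
      rw [hZ, hY]
      simp only [map_mul, map_inv, hX, hW]; decide +kernel
  have hQQ (a b : Fin 4) : Q a * Q b = τ ^ (quaternionSign a b).val * Q (a ^^^ b) := by
    have h1 : (1 : ZMod 2).val = 1 := rfl
    fin_cases a <;> fin_cases b <;>
      simp [Q, quaternionSign, h1, hXX, hYY, hZZ, hXY, hYX, hYZ, hZY, hXZ, hZX]
  have hWQ (a : Fin 4) : W * Q a = Q (rotation.1 a) * W := by
    fin_cases a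
    · change W * 1 = 1 * W
      simp
    · exact conjX
    · exact conjY
    · exact conjZ
  have hWQpow (n : ℕ) (a : Fin 4) : W ^ n * Q a = Q ((rotation ^ n).1 a) * W ^ n := by
    induction n with
    | zero => simp
    | succ n ih =>
      rw [pow_succ', mul_assoc, ih, ← mul_assoc, hWQ, mul_assoc]
      rw [pow_succ' rotation]
      rfl
  refine ⟨fun g => Q (g.1 0) * W ^ rotationIndex g, τ, hτk, by rw [sq, hττ], fun g => ?_,
    fun g h => ?_⟩
  · rw [map_mul, map_pow, hQ, hW, klein_mul_rotation_pow]
  · have hxor : ∀ a b : Fin 4, a ^^^ (a ^^^ b) = b := by decide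
    have hWW : W ^ rotationIndex g * W ^ rotationIndex h = W ^ rotationIndex (g * h) := by
      rw [rotationIndex_mul, ← pow_add]
      exact pow_eq_pow_mod _ hW3
    calc Q (g.1 0) * W ^ rotationIndex g * (Q (h.1 0) * W ^ rotationIndex h)
        = Q (g.1 0) * (W ^ rotationIndex g * Q (h.1 0)) * W ^ rotationIndex h := by group
      _ = Q (g.1 0) * Q (g.1 0 ^^^ g.1 (h.1 0)) *
          (W ^ rotationIndex g * W ^ rotationIndex h) := by
        rw [hWQpow, rotation_pow_apply]; simp only [mul_assoc]
      _ = τ ^ (tetrahedralCocycle g h).val *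
          (Q ((g * h).1 0) * W ^ rotationIndex (g * h)) := by
        rw [hQQ, hxor, hWW, mul_assoc]; rfl

/-- Every `2`-cocycle with coefficients in a group divisible by `3` is cohomologous to an image
of `tetrahedralCocycle`. -/
theorem exists_eq_tetrahedralCocycle_add_coboundary {A : Type*} [AddCommGroup A]
    (hA : ∀ a : A, ∃ b : A, 3 • b = a) {u : alternatingGroup (Fin 4) → alternatingGroup (Fin 4) → A}
    (hu : IsTwoCocycle u) :
    ∃ (e : ZMod 2 →+ A) (ψ : alternatingGroup (Fin 4) → A),
      ∀ g h, u g h = e (tetrahedralCocycle g h) + (ψ h - ψ (g * h) + ψ g) := by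
  obtain ⟨σ, τ, hτ, hτ2, hσ, hmul⟩ := exists_quaternion_section (CocycleExtension.proj hu)
    CocycleExtension.proj_surjective CocycleExtension.ker_proj_le_center (fun k hk => by
      obtain ⟨a, rfl⟩ := CocycleExtension.exists_incl_eq hk
      obtain ⟨b, rfl⟩ := hA a
      exact ⟨CocycleExtension.incl hu (.ofAdd b), rfl, by rw [← map_pow]; rfl⟩)
  obtain ⟨s, rfl⟩ := CocycleExtension.exists_incl_eq hτ
  have hs : 2 • s = 0 := by
    rw [← map_pow] at hτ2
    exact congrArg Multiplicative.toAdd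
      (CocycleExtension.incl_injective (hτ2.trans (map_one (CocycleExtension.incl hu)).symm))
  let e : ZMod 2 →+ A := ZMod.lift 2 ⟨zmultiplesHom A s, by simpa [← natCast_zsmul] using hs⟩
  have he (x : ZMod 2) : e x = x.val • s := by
    have h : ((x.val : ℤ) : ZMod 2) = x := by simp
    conv_lhs => rw [← h]
    simp only [e, ZMod.lift_coe]
    exact natCast_zsmul s x.val
  refine ⟨e, fun g => -(σ g).coeff, fun g h => ?_⟩
  have hb (g) : (σ g).base = g := hσ g
  have := congrArg CocycleExtension.coeff (hmul g h)
  rw [← map_pow, ← ofAdd_nsmul] at this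
  simp only [CocycleExtension.coeff_mul, CocycleExtension.incl_apply_coeff, hb,
    CocycleExtension.incl_apply_base, toAdd_ofAdd,
    CocycleExtension.cocycle_one_left hu (g * h)] at this
  rw [he, eq_comm, ← sub_eq_zero]
  rw [← sub_eq_zero] at this
  rw [← neg_eq_zero, ← this]
  simp only [sub_neg_eq_add]
  abel

theorem mem_range_barDelta_of_evalTwo_eq_zero {z : (Fin 2 → alternatingGroup (Fin 4)) →₀ ℤ}
    (hz : barDelta (alternatingGroup (Fin 4)) 1 z = 0) (h0 : evalTwo tetrahedralCocycle z = 0) :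
    z ∈ LinearMap.range (barDelta (alternatingGroup (Fin 4)) 2) := by
  by_contra hmem
  obtain ⟨c, hcz⟩ := CharacterModule.exists_character_apply_ne_zero_of_ne_zero
    (mt (Submodule.Quotient.mk_eq_zero _).mp hmem)
  let φ := c.toIntLinearMap ∘ₗ (LinearMap.range (barDelta (alternatingGroup (Fin 4)) 2)).mkQ
  have hφ (w) : φ (barDelta (alternatingGroup (Fin 4)) 2 w) = 0 := by
    have : (LinearMap.range (barDelta (alternatingGroup (Fin 4)) 2)).mkQ
      (barDelta (alternatingGroup (Fin 4)) 2 w) = 0 := by simp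
    simp only [φ, LinearMap.comp_apply, this, map_zero]
  obtain ⟨e, ψ, hψ⟩ := exists_eq_tetrahedralCocycle_add_coboundary
    (fun a => ⟨DivisibleBy.div a (3 : ℤ), by
      rw [← natCast_zsmul]; exact DivisibleBy.div_cancel a (three_ne_zero (α := ℤ))⟩)
    (isTwoCocycle_single φ hφ)
  have hdecomp (y) : φ y = e (evalTwo tetrahedralCocycle y) +
      evalTwo (fun g h => ψ h - ψ (g * h) + ψ g) y := by
    induction y using Finsupp.induction_linear with
    | zero => simp
    | add x y hx hy => simp only [map_add, hx, hy]; abel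
    | single x n =>
      have hx : x = ![x 0, x 1] := by ext i; fin_cases i <;> rfl
      rw [evalTwo_single, evalTwo_single, map_zsmul, ← smul_add, ← hψ, ← hx, ← map_zsmul,
        Finsupp.smul_single, smul_eq_mul, mul_one]
  apply hcz
  change φ z = 0
  rw [hdecomp, h0, evalTwo_coboundary, hz, map_zero, map_zero, add_zero]

theorem exists_cycle_evalTwo_eq_one : ∃ z, barDelta (alternatingGroup (Fin 4)) 1 z = 0 ∧
    evalTwo tetrahedralCocycle z = 1 := by
  have hcomm : klein 1 * klein 2 = klein 2 * klein 1 := by decide +kernel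
  have hval : tetrahedralCocycle (klein 1) (klein 2)
      - tetrahedralCocycle (klein 2) (klein 1) = 1 := by
    decide +kernel
  refine ⟨Finsupp.single ![klein 1, klein 2] 1 - Finsupp.single ![klein 2, klein 1] 1, ?_, ?_⟩
  · simp only [map_sub, barDelta_one_single, Matrix.cons_val_zero, Matrix.cons_val_one, hcomm]
    abel
  · simpa [evalTwo_single] using hval

end AlternatingFour

/-- `H₂(A₄; ℤ) ≅ ℤ/2ℤ`: the second integral group homology of the alternating group
on 4 letters is cyclic of order 2. -/
theorem stmt_13 :
    Nonempty (barH2 (alternatingGroup (Fin 4)) ≃ₗ[ℤ] ZMod 2) := by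
  let Φ := evalTwo AlternatingFour.tetrahedralCocycle ∘ₗ
    (LinearMap.ker (barDelta (alternatingGroup (Fin 4)) 1)).subtype
  have hsurj : Function.Surjective Φ := by
    obtain ⟨z, hz, hz1⟩ := AlternatingFour.exists_cycle_evalTwo_eq_one
    intro x
    refine ⟨(x.val : ℤ) • ⟨z, hz⟩, ?_⟩
    have h1 : Φ ⟨z, hz⟩ = 1 := hz1
    rw [map_zsmul, h1]
    simp
  have hker : (LinearMap.range (barDelta (alternatingGroup (Fin 4)) 2)).comap
      (LinearMap.ker (barDelta (alternatingGroup (Fin 4)) 1)).subtype = LinearMap.ker Φ := by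
    ext z
    refine ⟨?_, fun h => AlternatingFour.mem_range_barDelta_of_evalTwo_eq_zero z.2 h⟩
    rintro ⟨w, hw⟩
    change evalTwo _ z.1 = 0
    rw [← Submodule.subtype_apply, ← hw]
    exact AlternatingFour.isTwoCocycle_tetrahedralCocycle.evalTwo_barDelta w
  exact ⟨(Submodule.quotEquivOfEq _ _ hker).trans (Φ.quotKerEquivOfSurjective hsurj)⟩
end
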